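/- For all positive integers m and k, P(there exists n ≥ 0 such that #K(n) = k and ξ(n) = m) ≥ (1 - 2q)^k. -/

import Mathlib

open MeasureTheory ProbabilityTheory Filter Set
open scoped ENNReal NNReal

variable {Ω : Type*}

/-- Partial sums of the steps: `S X n = X 0 + ⋯ + X (n-1)` (the walk started at `0`). -/
noncomputable def S (X : ℕ → Ω → ℤ) (n : ℕ) (ω : Ω) : ℤ :=
  ∑ i ∈ Finset.range n, X i ω

/-- The local time at site `z` up to time `n`: `ξ(z,n) = #{k : 0 < k ≤ n, S_k = z}`. -/
noncomputable def localTime (X : ℕ → Ω → ℤ) (z : ℤ) (n : ℕ) (ω : Ω) : ℕ :=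
  ((Finset.Icc 1 n).filter (fun k => S X k ω = z)).card

/-- The maximal local time `ξ(n) = max_{y ∈ ℤ} ξ(y,n)`. -/
noncomputable def maxLocalTime (X : ℕ → Ω → ℤ) (n : ℕ) (ω : Ω) : ℕ :=
  sSup (Set.range fun z : ℤ => localTime X z n ω)

/-- The set of favorite sites at time `n`: `K(n) = {z : ξ(z,n) = ξ(n)}`. -/
noncomputable def favSites (X : ℕ → Ω → ℤ) (n : ℕ) (ω : Ω) : Set ℤ :=
  {z : ℤ | localTime X z n ω = maxLocalTime X n ω}

/-- The total local time at site `z`: `ξ(z,∞) = #{k > 0 : S_k = z}` (as an extended natural). -/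
noncomputable def totalLocalTime (X : ℕ → Ω → ℤ) (z : ℤ) (ω : Ω) : ℕ∞ :=
  {k : ℕ | 0 < k ∧ S X k ω = z}.encard

/-- `X` is a sequence of i.i.d. steps with `P(X_i = 1) = p`, `P(X_i = -1) = q`. -/
def IsAsymmetricSRW [MeasurableSpace Ω] (P : Measure Ω) (X : ℕ → Ω → ℤ) (p q : ℝ) : Prop :=
  (∀ i, Measurable (X i)) ∧
  iIndepFun X P ∧
  (∀ i, P {ω | X i ω = 1} = ENNReal.ofReal p) ∧
  (∀ i, P {ω | X i ω = -1} = ENNReal.ofReal q)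

/-- sigma-algebra generated by the steps with index in `s` -/
def Fs (X : ℕ → Ω → ℤ) (s : Set ℕ) : MeasurableSpace Ω :=
  ⨆ i ∈ s, MeasurableSpace.comap (X i) inferInstance

lemma Fs_mono (X : ℕ → Ω → ℤ) {s t : Set ℕ} (h : s ⊆ t) : Fs X s ≤ Fs X t :=
  biSup_mono h

lemma Fs_le [m0 : MeasurableSpace Ω] {X : ℕ → Ω → ℤ} (hX : ∀ i, Measurable (X i)) (s : Set ℕ) :
    Fs X s ≤ m0 :=
  iSup₂_le fun i _ => (hX i).comap_le

lemma Fs_meas (X : ℕ → Ω → ℤ) (s : Finset ℕ) (A : Set Ω)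
    (hA : ∀ ω ω', (∀ i ∈ s, X i ω = X i ω') → ω ∈ A → ω' ∈ A) :
    MeasurableSet[Fs X s] A := by
  have : A = ⋃ v ∈ {v : s → ℤ | ∃ ω ∈ A, ∀ i : s, X i ω = v i}, ⋂ i : s, X i ⁻¹' {v i} := by
    ext ω
    simp only [Set.mem_iUnion, Set.mem_iInter, Set.mem_preimage, Set.mem_singleton_iff,
      Set.mem_ofPred_eq]
    constructor
    · intro h
      exact ⟨fun i => X i ω, ⟨ω, h, fun i => rfl⟩, fun i => rfl⟩
    · rintro ⟨v, ⟨ω', h', h1⟩, h2⟩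
      exact hA ω' ω (fun i hi => by rw [h1 ⟨i, hi⟩, h2 ⟨i, hi⟩]) h'
  rw [this]
  refine @MeasurableSet.biUnion Ω _ (Fs X s) _ _ (Set.to_countable _) fun v _ => ?_
  refine @MeasurableSet.iInter Ω _ (Fs X s) _ _ fun i => ?_
  have hle : MeasurableSpace.comap (X i) inferInstance ≤ Fs X s :=
    le_iSup₂_of_le (f := fun (i : ℕ) (_ : i ∈ (s : Set ℕ)) =>
      MeasurableSpace.comap (X i) inferInstance) (i : ℕ) i.2 le_rfl
  exact hle _ ⟨{v i}, measurableSet_singleton _, rfl⟩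

lemma Fs_indep [MeasurableSpace Ω] {P : Measure Ω} {X : ℕ → Ω → ℤ}
    (hX : ∀ i, Measurable (X i)) (hi : iIndepFun X P) (n : ℕ) {A B : Set Ω}
    (hA : MeasurableSet[Fs X (Set.Iio n)] A) (hB : MeasurableSet[Fs X (Set.Ici n)] B) :
    P (A ∩ B) = P A * P B := by
  have := indep_iSup_of_disjoint (fun i => (hX i).comap_le) hi
    (S := Set.Iio n) (T := Set.Ici n) (by
      rw [Set.disjoint_left]; intro a ha hb; simp at ha hb; omega)
  exact (Indep_iff _ _ _).1 this A B hA hB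

lemma Fs_meas_past (X : ℕ → Ω → ℤ) (n : ℕ) (A : Set Ω)
    (hA : ∀ ω ω', (∀ i < n, X i ω = X i ω') → ω ∈ A → ω' ∈ A) :
    MeasurableSet[Fs X (Set.Iio n)] A := by
  refine Fs_mono X ?_ _ (Fs_meas X (Finset.range n) A fun ω ω' h => hA ω ω' fun i hi => h i (by simpa))
  intro i; simp

lemma Fs_meas_future (X : ℕ → Ω → ℤ) (n L : ℕ) (A : Set Ω)
    (hA : ∀ ω ω', (∀ i < L, X (n + i) ω = X (n + i) ω') → ω ∈ A → ω' ∈ A) :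
    MeasurableSet[Fs X (Set.Ici n)] A := by
  refine Fs_mono X ?_ _ (Fs_meas X (Finset.Ico n (n + L)) A
    fun ω ω' h => hA ω ω' fun i hi => h (n + i) (by simp; omega))
  intro i; simp; omega

/-- the walk after time `i`, started at `a`, goes to `≤ 0` within `L` steps -/
def Hit (X : ℕ → Ω → ℤ) (i L : ℕ) (a : ℤ) : Set Ω :=
  {ω | ∃ l ≤ L, a + ∑ j ∈ Finset.range l, X (i + j) ω ≤ 0}

lemma Hit_meas (X : ℕ → Ω → ℤ) (i L : ℕ) (a : ℤ) :
    MeasurableSet[Fs X (Set.Ici i)] (Hit X i L a) := by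
  refine Fs_meas_future X i L _ ?_
  rintro ω ω' h ⟨l, hl, h1⟩
  refine ⟨l, hl, ?_⟩
  rw [← Finset.sum_congr rfl (fun j hj => h j (by simp at hj; omega))]
  exact h1

lemma ae_pm [MeasurableSpace Ω] {P : Measure Ω} [IsProbabilityMeasure P]
    {X : ℕ → Ω → ℤ} {p q : ℝ} (hq0 : 0 < q) (hq : q < 1/2) (hpq : p + q = 1)
    (hX : IsAsymmetricSRW P X p q) (i : ℕ) : P {ω | ¬ (X i ω = 1 ∨ X i ω = -1)} = 0 := by
  obtain ⟨h1, h2, h3, h4⟩ := hX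
  have hm : ∀ a, MeasurableSet {ω | X i ω = a} := fun a => h1 i (measurableSet_singleton a)
  have : P ({ω | X i ω = 1} ∪ {ω | X i ω = -1}) = 1 := by
    rw [measure_union _ (hm _), h3, h4, ← ENNReal.ofReal_add (by linarith) hq0.le, hpq,
      ENNReal.ofReal_one]
    rw [Set.disjoint_left]; intro ω ha hb; simp at ha hb; omega
  have h5 := (prob_compl_eq_zero_iff ((hm 1).union (hm (-1)))).2 this
  exact h5

lemma Hit_bound [MeasurableSpace Ω] {P : Measure Ω} [IsProbabilityMeasure P]
    {X : ℕ → Ω → ℤ} {p q : ℝ} (hq0 : 0 < q) (hq : q < 1/2) (hpq : p + q = 1)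
    (hX : IsAsymmetricSRW P X p q) (L : ℕ) : ∀ (i a : ℕ),
    P (Hit X i L a) ≤ ENNReal.ofReal ((q / p) ^ a) := by
  have hp : 0 < p := by linarith
  induction L with
  | zero =>
    intro i a
    rcases Nat.eq_zero_or_pos a with rfl | ha
    · simpa using prob_le_one
    · have : Hit X i 0 a = ∅ := by
        ext ω; simp [Hit]; omega
      rw [this]; simp
  | succ L ih =>
    intro i a
    rcases a with _ | a
    · simpa using prob_le_one
    have hsub : Hit X i (L+1) ((a+1 : ℕ) : ℤ) ⊆
        (({ω | X i ω = 1} ∩ Hit X (i+1) L ((a+2 : ℕ) : ℤ)) ∪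
        ({ω | X i ω = -1} ∩ Hit X (i+1) L (a : ℤ))) ∪ {ω | ¬ (X i ω = 1 ∨ X i ω = -1)} := by
      rintro ω ⟨l, hl, h⟩
      rcases l with _ | l
      · simp at h; omega
      rw [Finset.sum_range_succ'] at h
      rw [Finset.sum_congr rfl (fun j _ => by rw [show i + (j + 1) = i + 1 + j by omega] :
        ∀ j ∈ Finset.range l, X (i + (j + 1)) ω = X (i + 1 + j) ω), add_zero] at h
      by_cases h1 : X i ω = 1
      · refine Or.inl (Or.inl ⟨h1, l, by omega, ?_⟩)
        rw [h1] at h; push_cast at h ⊢; linarith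
      by_cases h2 : X i ω = -1
      · refine Or.inl (Or.inr ⟨h2, l, by omega, ?_⟩)
        rw [h2] at h; push_cast at h ⊢; linarith
      · exact Or.inr (by simp [h1, h2])
    have hA : ∀ c : ℤ, MeasurableSet[Fs X (Set.Iio (i+1))] {ω | X i ω = c} := fun c =>
      Fs_meas_past X (i+1) _ (fun ω ω' h h' => by
        have := h i (by omega); simp only [Set.mem_ofPred_eq] at h' ⊢; rw [← this]; exact h')
    calc P (Hit X i (L+1) ((a+1 : ℕ) : ℤ)) ≤ _ := measure_mono hsub
      _ ≤ _ := measure_union_le _ _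
      _ ≤ _ := add_le_add (measure_union_le _ _) (ae_pm hq0 hq hpq hX i).le
      _ ≤ ENNReal.ofReal p * ENNReal.ofReal ((q/p)^(a+2)) +
          ENNReal.ofReal q * ENNReal.ofReal ((q/p)^a) := by
        rw [add_zero, Fs_indep hX.1 hX.2.1 (i+1) (hA 1) (Hit_meas X _ _ _),
          Fs_indep hX.1 hX.2.1 (i+1) (hA (-1)) (Hit_meas X _ _ _), hX.2.2.1, hX.2.2.2]
        gcongr
        · exact ih _ _
        · exact ih _ _
      _ = ENNReal.ofReal ((q/p)^(a+1)) := by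
        rw [← ENNReal.ofReal_mul hp.le, ← ENNReal.ofReal_mul hq0.le,
          ← ENNReal.ofReal_add (by positivity) (by positivity)]
        congr 1
        have h1 : p * (q/p)^(a+2) = q * (q/p)^(a+1) := by
          rw [pow_succ (q/p) (a+1)]; field_simp
        have h2 : q * (q/p)^a = p * (q/p)^(a+1) := by
          rw [pow_succ (q/p) a]; field_simp
        rw [h1, h2, ← add_mul, add_comm q p, hpq, one_mul]

/-- after time `n` the walk stays strictly above `S n` -/
def Esc (X : ℕ → Ω → ℤ) (n : ℕ) : Set Ω := {ω | ∀ l > n, S X n ω < S X l ω}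

lemma S_add (X : ℕ → Ω → ℤ) (n l : ℕ) (ω : Ω) :
    S X (n + l) ω = S X n ω + ∑ j ∈ Finset.range l, X (n + j) ω := by
  simp [S, Finset.sum_range_add]

lemma Esc_eq (X : ℕ → Ω → ℤ) (n : ℕ) :
    Esc X n = ⋂ l : ℕ, {ω | 0 < ∑ j ∈ Finset.range (l+1), X (n + j) ω} := by
  ext ω
  simp only [Esc, Set.mem_ofPred_eq, Set.mem_iInter]
  constructor
  · intro h l
    have := h (n + (l+1)) (by omega)
    rw [S_add] at this; linarith
  · intro h l hl
    obtain ⟨c, rfl⟩ : ∃ c, l = n + (c+1) := ⟨l - n - 1, by omega⟩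
    have := h c
    rw [S_add]; linarith

lemma Esc_meas (X : ℕ → Ω → ℤ) (n : ℕ) :
    MeasurableSet[Fs X (Set.Ici n)] (Esc X n) := by
  rw [Esc_eq]
  refine @MeasurableSet.iInter Ω _ (Fs X _) _ _ fun l => ?_
  refine Fs_meas_future X n (l+1) _ ?_
  intro ω ω' h h'
  simp only [Set.mem_ofPred_eq] at h' ⊢
  rwa [← Finset.sum_congr rfl (fun j hj => h j (by simpa using hj))]

lemma Esc_prob [MeasurableSpace Ω] {P : Measure Ω} [IsProbabilityMeasure P]
    {X : ℕ → Ω → ℤ} {p q : ℝ} (hq0 : 0 < q) (hq : q < 1/2) (hpq : p + q = 1)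
    (hX : IsAsymmetricSRW P X p q) (n : ℕ) : ENNReal.ofReal (1 - 2*q) ≤ P (Esc X n) := by
  have hp : 0 < p := by linarith
  have hU : P (⋃ L, Hit X (n+1) L 1) ≤ ENNReal.ofReal (q/p) := by
    have hmono : Monotone fun L => Hit X (n+1) L 1 := by
      rintro a b hab ω ⟨l, hl, h⟩
      exact ⟨l, hl.trans hab, h⟩
    rw [hmono.measure_iUnion]
    refine iSup_le fun L => ?_
    simpa using Hit_bound hq0 hq hpq hX L (n+1) 1
  have hA : MeasurableSet[Fs X (Set.Iio (n+1))] {ω | X n ω = 1} :=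
      Fs_meas_past X (n+1) _ (fun ω ω' h h' => by
        have := h n (by omega); simp only [Set.mem_ofPred_eq] at h' ⊢; rw [← this]; exact h')
  have hUm : MeasurableSet[Fs X (Set.Ici (n+1))] (⋃ L, Hit X (n+1) L 1) :=
    @MeasurableSet.iUnion Ω _ (Fs X _) _ _ fun L => Hit_meas X _ _ _
  have hsub : (Esc X n)ᶜ ⊆ ({ω | X n ω = -1} ∪ ({ω | X n ω = 1} ∩ ⋃ L, Hit X (n+1) L 1)) ∪
      {ω | ¬ (X n ω = 1 ∨ X n ω = -1)} := by
    intro ω h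
    by_cases h2 : X n ω = -1
    · exact Or.inl (Or.inl h2)
    by_cases h1 : X n ω = 1
    · refine Or.inl (Or.inr ⟨h1, ?_⟩)
      rw [Esc_eq] at h
      simp only [Set.mem_compl_iff, Set.mem_iInter, Set.mem_ofPred_eq, not_forall, not_lt] at h
      obtain ⟨l, hl⟩ := h
      rw [Finset.sum_range_succ'] at hl
      rw [Finset.sum_congr rfl (fun j _ => by rw [show n + (j + 1) = n + 1 + j by omega] :
        ∀ j ∈ Finset.range l, X (n + (j + 1)) ω = X (n + 1 + j) ω), add_zero] at hl
      refine Set.mem_iUnion.2 ⟨l, l, le_rfl, ?_⟩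
      rw [h1] at hl; linarith
    · exact Or.inr (by simp [h1, h2])
  have hc : P (Esc X n)ᶜ ≤ ENNReal.ofReal (2*q) := by
    calc P (Esc X n)ᶜ ≤ _ := measure_mono hsub
      _ ≤ _ := measure_union_le _ _
      _ ≤ _ := add_le_add (measure_union_le _ _) (ae_pm hq0 hq hpq hX n).le
      _ ≤ ENNReal.ofReal q + ENNReal.ofReal p * ENNReal.ofReal (q/p) := by
        rw [add_zero, Fs_indep hX.1 hX.2.1 (n+1) hA hUm, hX.2.2.1, hX.2.2.2]
        gcongr
      _ = ENNReal.ofReal (2*q) := by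
        rw [← ENNReal.ofReal_mul hp.le, ← ENNReal.ofReal_add hq0.le (by positivity)]
        congr 1
        field_simp; ring
  have hm : MeasurableSet (Esc X n) := Fs_le hX.1 _ _ (Esc_meas X n)
  rw [prob_compl_eq_one_sub hm] at hc
  rw [ENNReal.ofReal_sub _ (by linarith), ENNReal.ofReal_one]
  exact tsub_le_iff_tsub_le.1 hc

/-- the block of length `2M` from `n` alternates -/
def Blk (X : ℕ → Ω → ℤ) (M n : ℕ) : Set Ω := {ω | ∀ i < 2*M, X (n+i) ω = (-1)^i}

lemma Blk_prob [MeasurableSpace Ω] {P : Measure Ω} [IsProbabilityMeasure P]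
    {X : ℕ → Ω → ℤ} {p q : ℝ} (hq0 : 0 < q) (hq : q < 1/2) (hpq : p + q = 1)
    (hX : IsAsymmetricSRW P X p q) (M n : ℕ) : ENNReal.ofReal q ^ (2*M) ≤ P (Blk X M n) := by
  have e : Blk X M n = ⋂ i ∈ Finset.Ico n (n + 2*M), X i ⁻¹' {(-1)^(i-n)} := by
    ext ω
    simp only [Blk, Set.mem_ofPred_eq, Set.mem_iInter, Finset.mem_Ico, Set.mem_preimage,
      Set.mem_singleton_iff]
    constructor
    · intro h i hi
      have := h (i - n) (by omega)
      rwa [show n + (i - n) = i by omega] at this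
    · intro h i hi
      have := h (n+i) (by omega)
      rwa [show n + i - n = i by omega] at this
  rw [e, hX.2.1.measure_inter_preimage_eq_mul _ (fun i _ => measurableSet_singleton _)]
  have : ENNReal.ofReal q ^ (2*M) = ∏ i ∈ Finset.Ico n (n + 2*M), ENNReal.ofReal q := by simp
  rw [this]
  refine Finset.prod_le_prod' fun i _ => ?_
  rcases neg_one_pow_eq_or ℤ (i - n) with h | h <;> rw [h]
  · exact (ENNReal.ofReal_le_ofReal (by linarith)).trans (hX.2.2.1 i).ge
  · exact (hX.2.2.2 i).ge

lemma Blk_sum (X : ℕ → Ω → ℤ) (M n : ℕ) (ω : Ω) (h : ω ∈ Blk X M n) (t : ℕ) (ht : t ≤ M) :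
    S X (n + 2*t) ω = S X n ω := by
  rw [S_add]
  have : ∑ j ∈ Finset.range (2*t), X (n + j) ω = ∑ j ∈ Finset.range (2*t), (-1 : ℤ)^j :=
    Finset.sum_congr rfl fun j hj => h j (by simp at hj; omega)
  rw [this, neg_one_geom_sum]; simp

lemma Blk_lt (X : ℕ → Ω → ℤ) (M n : ℕ) (ω : Ω) (h : ω ∈ Blk X M n) :
    M ≤ localTime X (S X n ω) (n + 2*M) ω := by
  unfold localTime
  calc M = ((Finset.Icc 1 M).image fun t => n + 2*t).card := by
        rw [Finset.card_image_of_injective _ (by intro a b hab; simp at hab; omega)]; simp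
    _ ≤ _ := by
        apply Finset.card_le_card
        intro x hx
        simp only [Finset.mem_image, Finset.mem_Icc] at hx
        obtain ⟨t, ht, rfl⟩ := hx
        simp only [Finset.mem_filter, Finset.mem_Icc]
        exact ⟨by omega, Blk_sum X M n ω h t ht.2⟩

lemma Blk_ae [MeasurableSpace Ω] {P : Measure Ω} [IsProbabilityMeasure P]
    {X : ℕ → Ω → ℤ} {p q : ℝ} (hq0 : 0 < q) (hq : q < 1/2) (hpq : p + q = 1)
    (hX : IsAsymmetricSRW P X p q) (M : ℕ) : ∀ᵐ ω ∂P, ∃ z n, M ≤ localTime X z n ω := by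
  set c := ENNReal.ofReal q ^ (2*M) with hc
  have hm : ∀ n, MeasurableSet[Fs X (Set.Ici n)] (Blk X M n) := fun n =>
    Fs_meas_future X n (2*M) _ fun ω ω' h h' i hi => by rw [← h i hi]; exact h' i hi
  have key : ∀ B : ℕ, P {ω | ∀ b < B, ω ∉ Blk X M (2*M*b)} ≤ (1 - c)^B := by
    intro B
    induction B with
    | zero => simpa using prob_le_one
    | succ B ih =>
      have e : {ω | ∀ b < B+1, ω ∉ Blk X M (2*M*b)} =
          {ω | ∀ b < B, ω ∉ Blk X M (2*M*b)} ∩ (Blk X M (2*M*B))ᶜ := by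
        ext ω
        simp only [Set.mem_ofPred_eq, Set.mem_inter_iff, Set.mem_compl_iff]
        constructor
        · intro h; exact ⟨fun b hb => h b (by omega), h B (by omega)⟩
        · rintro ⟨h, h'⟩ b hb
          rcases Nat.lt_succ_iff_lt_or_eq.1 hb with h1 | rfl
          · exact h b h1
          · exact h'
      rw [e, Fs_indep hX.1 hX.2.1 (2*M*B) _ (hm _).compl, pow_succ]
      · gcongr
        rw [prob_compl_eq_one_sub (Fs_le hX.1 _ _ (hm _))]
        gcongr
        exact Blk_prob hq0 hq hpq hX M _
      · refine Fs_meas_past X _ _ ?_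
        intro ω ω' h h' b hb hbl
        refine h' b hb fun i hi => ?_
        rw [h _ _]
        · exact hbl i hi
        · have : 2*M*(b+1) ≤ 2*M*B := Nat.mul_le_mul_left _ hb
          rw [mul_add] at this
          omega
  have h0 : P {ω | ∀ b, ω ∉ Blk X M (2*M*b)} = 0 := by
    have hlim : Tendsto (fun B : ℕ => (1 - c)^B) atTop (nhds 0) := by
      apply ENNReal.tendsto_pow_atTop_nhds_zero_of_lt_one
      refine ENNReal.sub_lt_self ENNReal.one_ne_top one_ne_zero ?_
      rw [hc]
      exact pow_ne_zero _ (by simpa using hq0)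
    refine le_antisymm (ge_of_tendsto' hlim fun B => le_trans (measure_mono ?_) (key B)) zero_le
    intro ω h b _
    exact h b
  have : ∀ᵐ ω ∂P, ¬ ∀ b, ω ∉ Blk X M (2*M*b) := by
    rw [ae_iff]; simpa using h0
  filter_upwards [this] with ω h
  push Not at h
  obtain ⟨b, hb⟩ := h
  exact ⟨_, _, Blk_lt X M _ ω hb⟩

/-- at time `n`: exactly `j` sites at level `m`, none above, all weakly left of the walk -/
def Dj (X : ℕ → Ω → ℤ) (m j n : ℕ) (ω : Ω) : Prop :=
  ∃ K : Finset ℤ, K.card = j ∧ (∀ z ∈ K, localTime X z n ω = m) ∧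
    (∀ z ∉ K, localTime X z n ω < m) ∧ ∀ z ∈ K, z ≤ S X n ω

lemma localTime_succ (X : ℕ → Ω → ℤ) (z : ℤ) (n : ℕ) (ω : Ω) :
    localTime X z (n+1) ω = localTime X z n ω + if S X (n+1) ω = z then 1 else 0 := by
  unfold localTime
  rw [← Finset.insert_Icc_right_eq_Icc_add_one (by omega), Finset.filter_insert]
  split_ifs with h
  · rw [Finset.card_insert_of_notMem (by simp)]
  · simp

lemma localTime_mono (X : ℕ → Ω → ℤ) (z : ℤ) (ω : Ω) : Monotone fun n => localTime X z n ω :=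
  monotone_nat_of_le_succ fun n => by simp only [localTime_succ]; omega

lemma S_congr (X : ℕ → Ω → ℤ) (n : ℕ) (ω ω' : Ω) (h : ∀ i < n, X i ω = X i ω') :
    S X n ω = S X n ω' :=
  Finset.sum_congr rfl fun i hi => h i (by simpa using hi)

lemma localTime_congr (X : ℕ → Ω → ℤ) (n : ℕ) (ω ω' : Ω) (h : ∀ i < n, X i ω = X i ω') (z : ℤ) :
    localTime X z n ω = localTime X z n ω' := by
  unfold localTime
  congr 1
  refine Finset.filter_congr fun l hl => ?_
  rw [S_congr X l ω ω' fun i hi => h i (by simp at hl; omega)]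

lemma Dj_congr (X : ℕ → Ω → ℤ) (m j n : ℕ) (ω ω' : Ω) (h : ∀ i < n, X i ω = X i ω') :
    Dj X m j n ω ↔ Dj X m j n ω' := by
  unfold Dj
  simp only [localTime_congr X n ω ω' h, S_congr X n ω ω' h]

lemma Dj_step (X : ℕ → Ω → ℤ) (m j n : ℕ) (ω : Ω) (hD : Dj X m j n ω) (hE : ω ∈ Esc X n)
    (hU : ∃ z l, m + 1 ≤ localTime X z l ω) : ∃ n', Dj X m (j+1) n' ω := by
  obtain ⟨K, hK, h1, h2, h3⟩ := hD
  -- the invariant along times with no new site at level m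
  have inv : ∀ d, (∀ d' < d, localTime X (S X (n+d'+1) ω) (n+d'+1) ω < m) →
      (∀ z ∈ K, localTime X z (n+d) ω = m) ∧ (∀ z ∉ K, localTime X z (n+d) ω < m) := by
    intro d
    induction d with
    | zero => intro _; exact ⟨h1, h2⟩
    | succ d ih =>
      intro hd
      obtain ⟨i1, i2⟩ := ih fun d' hd' => hd d' (by omega)
      constructor
      · intro z hz
        have ha := hE (n+d+1) (by omega)
        have hb := h3 z hz
        rw [← add_assoc, localTime_succ, i1 z hz, if_neg (by omega), add_zero]
      · intro z hz
        rw [← add_assoc]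
        by_cases hs : S X (n+d+1) ω = z
        · rw [← hs]; exact hd d (by omega)
        · rw [localTime_succ, if_neg hs]; exact i2 z hz
  have ex : ∃ d, m ≤ localTime X (S X (n+d+1) ω) (n+d+1) ω := by
    by_contra hcon
    push Not at hcon
    obtain ⟨z, l, hz⟩ := hU
    obtain ⟨i1, i2⟩ := inv l fun d' _ => hcon d'
    have := localTime_mono X z ω (show l ≤ n + l by omega)
    simp only at this
    by_cases hzK : z ∈ K
    · have := i1 z hzK; omega
    · have := i2 z hzK; omega
  classical
  have hf := Nat.find_spec ex
  have hmin : ∀ d' < Nat.find ex, localTime X (S X (n+d'+1) ω) (n+d'+1) ω < m :=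
    fun d' hd' => not_le.1 (Nat.find_min ex hd')
  set d := Nat.find ex
  obtain ⟨i1, i2⟩ := inv d hmin
  have hlt := hE (n+d+1) (by omega)
  have hy : S X (n+d+1) ω ∉ K := fun hy => by have := h3 _ hy; omega
  have hy2 := i2 _ hy
  refine ⟨n+d+1, insert (S X (n+d+1) ω) K, ?_, ?_, ?_, ?_⟩
  · rw [Finset.card_insert_of_notMem hy, hK]
  · intro z hz
    rcases Finset.mem_insert.1 hz with rfl | hz
    · rw [localTime_succ, if_pos rfl] at hf ⊢
      omega
    · have hb := h3 z hz
      rw [localTime_succ, if_neg (by omega), i1 z hz, add_zero]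
  · intro z hz
    rw [Finset.mem_insert, not_or] at hz
    rw [localTime_succ, if_neg (Ne.symm hz.1)]
    exact i2 z hz.2
  · intro z hz
    rcases Finset.mem_insert.1 hz with rfl | hz
    · exact le_rfl
    · have := h3 z hz
      omega

lemma Dj_prob [MeasurableSpace Ω] {P : Measure Ω} [IsProbabilityMeasure P]
    {X : ℕ → Ω → ℤ} {p q : ℝ} (hq0 : 0 < q) (hq : q < 1/2) (hpq : p + q = 1)
    (hX : IsAsymmetricSRW P X p q) (m : ℕ) (hm : 1 ≤ m) (j : ℕ) :
    ENNReal.ofReal (1 - 2*q) ^ j ≤ P {ω | ∃ n, Dj X m j n ω} := by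
  induction j with
  | zero =>
    have : {ω | ∃ n, Dj X m 0 n ω} = Set.univ := by
      refine Set.eq_univ_of_forall fun ω => ⟨0, ∅, by simp, by simp, ?_, by simp⟩
      intro z _
      simp [localTime]; omega
    rw [this]; simp
  | succ j ih =>
    set N : ℕ → Set Ω := fun n => {ω | Dj X m j n ω ∧ ∀ i < n, ¬ Dj X m j i ω} with hN
    have hNF : ∀ n, MeasurableSet[Fs X (Set.Iio n)] (N n) := by
      intro n
      refine Fs_meas_past X n _ ?_
      rintro ω ω' h ⟨ha, hb⟩
      refine ⟨(Dj_congr X m j n ω ω' h).1 ha, fun i hi hc => hb i hi ?_⟩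
      exact (Dj_congr X m j i ω ω' fun i' hi' => h i' (by omega)).2 hc
    have hNm : ∀ n, MeasurableSet (N n) := fun n => Fs_le hX.1 _ _ (hNF n)
    have hEm : ∀ n, MeasurableSet (Esc X n) := fun n => Fs_le hX.1 _ _ (Esc_meas X n)
    have hdis : Pairwise (Function.onFun Disjoint N) := by
      intro a b hab
      rw [Function.onFun, Set.disjoint_left]
      rintro ω ⟨ha, ha'⟩ ⟨hb, hb'⟩
      rcases lt_or_gt_of_ne hab with h | h
      · exact hb' a h ha
      · exact ha' b h hb
    have hUn : {ω | ∃ n, Dj X m j n ω} = ⋃ n, N n := by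
      ext ω
      simp only [Set.mem_ofPred_eq, Set.mem_iUnion, hN]
      constructor
      · intro h
        classical
        exact ⟨Nat.find h, Nat.find_spec h, fun i hi => Nat.find_min h hi⟩
      · rintro ⟨n, h, _⟩; exact ⟨n, h⟩
    have hle : P (⋃ n, N n ∩ Esc X n) ≤ P {ω | ∃ n, Dj X m (j+1) n ω} := by
      refine measure_mono_ae ?_
      filter_upwards [Blk_ae hq0 hq hpq hX (m+1)] with ω hω h
      obtain ⟨n, hn, hE⟩ := Set.mem_iUnion.1 h
      exact Dj_step X m j n ω hn.1 hE hω
    refine le_trans ?_ hle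
    rw [measure_iUnion (fun a b hab => (hdis hab).mono Set.inter_subset_left Set.inter_subset_left)
      (fun n => (hNm n).inter (hEm n))]
    calc ENNReal.ofReal (1 - 2*q) ^ (j+1)
        ≤ P {ω | ∃ n, Dj X m j n ω} * ENNReal.ofReal (1 - 2*q) := by
          rw [pow_succ]; gcongr
      _ = ∑' n, P (N n) * ENNReal.ofReal (1 - 2*q) := by
          rw [hUn, measure_iUnion hdis hNm, ENNReal.tsum_mul_right]
      _ ≤ ∑' n, P (N n ∩ Esc X n) := by
          refine ENNReal.tsum_le_tsum fun n => ?_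
          rw [Fs_indep hX.1 hX.2.1 n (hNF n) (Esc_meas X n)]
          gcongr
          exact Esc_prob hq0 hq hpq hX n

/-- For all positive integers `m` and `k`,
`P(∃ n ≥ 0, #K(n) = k and ξ(n) = m) ≥ (1-2q)^k`. -/
theorem prob_k_favorite_sites_at_level_m
    [MeasurableSpace Ω] (P : Measure Ω) [IsProbabilityMeasure P]
    (X : ℕ → Ω → ℤ) (p q : ℝ) (hq0 : 0 < q) (hq : q < 1/2) (hpq : p + q = 1)
    (hX : IsAsymmetricSRW P X p q) (m k : ℕ) (hm : 1 ≤ m) (hk : 1 ≤ k) :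
    ENNReal.ofReal ((1 - 2*q) ^ k)
      ≤ P {ω | ∃ n : ℕ, (favSites X n ω).ncard = k ∧ maxLocalTime X n ω = m} := by
  rw [ENNReal.ofReal_pow (by linarith)]
  refine (Dj_prob hq0 hq hpq hX m hm k).trans (measure_mono ?_)
  rintro ω ⟨n, K, hK, h1, h2, -⟩
  have hmax : maxLocalTime X n ω = m := by
    have hne : K.Nonempty := Finset.card_pos.1 (by omega)
    obtain ⟨z, hz⟩ := hne
    refine IsGreatest.csSup_eq ⟨⟨z, h1 z hz⟩, ?_⟩
    rintro _ ⟨y, rfl⟩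
    by_cases hy : y ∈ K
    · exact (h1 y hy).le
    · exact (h2 y hy).le
  refine ⟨n, ?_, hmax⟩
  have : favSites X n ω = K := by
    ext z
    simp only [favSites, Set.mem_ofPred_eq, hmax, Finset.mem_coe]
    constructor
    · intro h
      by_contra hc
      have := h2 z hc
      omega
    · exact h1 z
  rw [this, Set.ncard_coe_finset, hK]
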